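/- arXiv:2203.05485 — 2 statements merged into one kernel-verified Lean document; each statement's English description precedes it below -/
import Mathlib

section
/- For every integer t ≥ 2 there exists a positive real constant C = C(t) such that for every positive integer n, the Turán number of the t×t grid graph F_t satisfies ex(n, F_t) ≤ C·n^{3/2}. That is, every simple graph on n vertices with more than C·n^{3/2} edges contains a subgraph isomorphic to F_t. -/
open SimpleGraph

/-- `G` contains a subgraph isomorphic to `H`: there is an injective graph
homomorphism from `H` to `G`. -/
def Contains {α β : Type*} (G : SimpleGraph α) (H : SimpleGraph β) : Prop :=
  ∃ f : H →g G, Function.Injective f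

/-- The `t × t` grid graph `F_t = P_t □ P_t`. -/
def gridGraph (t : ℕ) : SimpleGraph (Fin t × Fin t) :=
  (pathGraph t).boxProd (pathGraph t)

open Finset in
/-- If the kernels before position `i` have column sums `1` and those from `i` on have row sums `1`,
the total weight of all sequences is the number of choices for the entry at position `i`. -/
lemma sum_prod_kernels {V : Type*} [Fintype V] (L : ℕ) :
    ∀ (i : ℕ) (K : ℕ → V → V → ℝ), i ≤ L →
      (∀ j < i, ∀ b, ∑ a, K j a b = 1) → (∀ j, i ≤ j → ∀ a, ∑ b, K j a b = 1) →
      ∑ w : Fin (L + 1) → V, ∏ j : Fin L, K j (w j.castSucc) (w j.succ) = Fintype.card V := by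
  induction L with
  | zero => intro i K _ _ _; simp
  | succ L ih =>
    intro i K hi hcol hrow
    rcases i with _ | i
    · rw [← (Fin.snocEquiv (fun _ : Fin (L + 2) => V)).sum_comp, Fintype.sum_prod_type_right,
        ← ih 0 K (Nat.zero_le _) (by simp) hrow]
      refine sum_congr rfl fun w _ => ?_
      simp only [Fin.snocEquiv, Equiv.coe_fn_mk, Fin.prod_univ_castSucc, ← Fin.castSucc_succ,
        Fin.snoc_castSucc, Fin.val_castSucc, Fin.succ_last, Fin.snoc_last, Fin.val_last]
      rw [← mul_sum, hrow _ (Nat.zero_le _), mul_one]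
    · rw [← (Fin.consEquiv (fun _ : Fin (L + 2) => V)).sum_comp, Fintype.sum_prod_type_right,
        ← ih i (fun j => K (j + 1)) (by omega) (fun j hj => hcol _ (by omega))
          (fun j hj => hrow _ (by omega))]
      refine sum_congr rfl fun w _ => ?_
      simp only [Fin.consEquiv, Equiv.coe_fn_mk, Fin.prod_univ_succ, Fin.castSucc_zero,
        Fin.cons_zero, Fin.cons_succ, Fin.castSucc_succ, Fin.val_zero, Fin.val_succ]
      rw [← sum_mul, hcol 0 (by omega), one_mul]

open Finset in
open scoped Classical in
/-- If every line in a direction `i ∈ I` that carries few points has small weight on average, some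
nonempty part of the support of `wt` meets each such line through one of its points at least `s`
times. -/
lemma exists_rich_subset {ι V : Type*} [Fintype ι] [DecidableEq ι] [Fintype V]
    (wt : (ι → V) → ℝ) (R : ι → (ι → V) → ℝ) (I : Finset ι) (s : ℕ) (c κ : ℝ)
    (hc : 0 ≤ c) (hκ : 0 ≤ κ) (hcκ : s * c ≤ κ * Fintype.card V)
    (hR : ∀ i ∈ I, ∀ w, 0 ≤ R i w)
    (hRu : ∀ i ∈ I, ∀ w v, R i (Function.update w i v) = R i w)
    (hle : ∀ i ∈ I, ∀ w, wt w ≤ c * R i w)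
    (htot : ∑ i ∈ I, κ * ∑ w, R i w < ∑ w, wt w) :
    ∃ W : Finset (ι → V), W.Nonempty ∧ (∀ w ∈ W, wt w ≠ 0) ∧
      ∀ w ∈ W, ∀ i ∈ I, s ≤ #{v | Function.update w i v ∈ W} := by
  let N (i : ι) (W : Finset (ι → V)) : Finset (ι → V) := {w | ∃ v, Function.update w i v ∈ W}
  let Good (W : Finset (ι → V)) : Prop :=
    (∀ w ∈ W, wt w ≠ 0) ∧ ∑ i ∈ I, κ * ∑ w ∈ N i W, R i w < ∑ w ∈ W, wt w
  have hstart : Good {w | wt w ≠ 0} := by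
    refine ⟨by simp, ?_⟩
    rw [sum_filter_ne_zero]
    refine lt_of_le_of_lt (sum_le_sum fun i hi => mul_le_mul_of_nonneg_left ?_ hκ) htot
    exact sum_le_sum_of_subset_of_nonneg (subset_univ _) fun w _ _ => hR i hi w
  obtain ⟨W, hW, hmin⟩ := exists_min_image (univ.filter Good) card ⟨_, by simpa using hstart⟩
  replace hW : Good W := by simpa using hW
  replace hmin : ∀ W', Good W' → #W ≤ #W' := fun W' h => hmin W' (by simpa using h)
  refine ⟨W, ?_, hW.1, fun w hw i hi => ?_⟩
  · rw [nonempty_iff_ne_empty]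
    rintro rfl
    simpa [N] using hW.2
  by_contra! hlt
  have hinj : Function.Injective (Function.update w i) := Function.update_injective w i
  let ℓ : Finset (ι → V) := univ.image (Function.update w i)
  have hwl : w ∈ ℓ := mem_image.2 ⟨w i, mem_univ _, Function.update_eq_self i w⟩
  have hRl : ∀ u ∈ ℓ, R i u = R i w := by
    intro u hu
    obtain ⟨v, -, rfl⟩ := mem_image.1 hu
    exact hRu i hi w v
  have hline : ℓ ⊆ N i W := by
    intro u hu
    obtain ⟨v, -, rfl⟩ := mem_image.1 hu
    simp only [N, mem_filter, mem_univ, true_and]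
    exact ⟨w i, by simpa using hw⟩
  have hsmall : #(W ∩ ℓ) ≤ s := by
    refine le_trans ?_ hlt.le
    rw [← card_image_of_injective _ hinj]
    refine card_le_card fun u hu => ?_
    obtain ⟨huW, hul⟩ := mem_inter.1 hu
    obtain ⟨v, -, rfl⟩ := mem_image.1 hul
    exact mem_image.2 ⟨v, by simpa using huW, rfl⟩
  have hmono : ∀ j, N j (W \ ℓ) ⊆ N j W := by
    intro j u hu
    simp only [N, mem_filter, mem_univ, true_and, mem_sdiff] at hu ⊢
    exact hu.imp fun v hv => hv.1
  have hdisj : N i (W \ ℓ) ⊆ N i W \ ℓ := by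
    intro u hu
    refine mem_sdiff.2 ⟨hmono i hu, fun hul => ?_⟩
    obtain ⟨v, -, rfl⟩ := mem_image.1 hul
    simp only [N, mem_filter, mem_univ, true_and, mem_sdiff] at hu
    obtain ⟨v', hv'⟩ := hu
    exact hv'.2 (mem_image.2 ⟨v', mem_univ _, by simp⟩)
  have hgood : Good (W \ ℓ) := by
    refine ⟨fun u hu => hW.1 u (mem_sdiff.1 hu).1, ?_⟩
    have h1 : ∑ u ∈ W ∩ ℓ, wt u ≤ s * c * R i w := by
      calc ∑ u ∈ W ∩ ℓ, wt u ≤ ∑ u ∈ W ∩ ℓ, c * R i w :=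
            sum_le_sum fun u hu => (hle i hi u).trans_eq (by rw [hRl u (mem_inter.1 hu).2])
        _ = #(W ∩ ℓ) * (c * R i w) := by rw [sum_const, nsmul_eq_mul]
        _ ≤ s * (c * R i w) := by
            have := mul_nonneg hc (hR i hi w)
            gcongr
        _ = s * c * R i w := by ring
    have h2 : ∑ u ∈ N i (W \ ℓ), R i u + Fintype.card V * R i w ≤ ∑ u ∈ N i W, R i u := by
      rw [← sum_sdiff hline, sum_congr rfl hRl, sum_const, nsmul_eq_mul,
        card_image_of_injective _ hinj, card_univ]
      have := sum_le_sum_of_subset_of_nonneg hdisj fun u _ _ => hR i hi u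
      linarith
    have h3 : ∑ j ∈ I, κ * ∑ u ∈ N j (W \ ℓ), R j u + s * c * R i w
        ≤ ∑ j ∈ I, κ * ∑ u ∈ N j W, R j u := by
      rw [← add_sum_erase _ _ hi, ← add_sum_erase I (fun j => κ * ∑ u ∈ N j W, R j u) hi]
      have h4 : ∑ j ∈ I.erase i, κ * ∑ u ∈ N j (W \ ℓ), R j u
          ≤ ∑ j ∈ I.erase i, κ * ∑ u ∈ N j W, R j u :=
        sum_le_sum fun j hj => mul_le_mul_of_nonneg_left
          (sum_le_sum_of_subset_of_nonneg (hmono j) fun u _ _ => hR j (mem_of_mem_erase hj) u) hκ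
      have h5 := mul_le_mul_of_nonneg_left h2 hκ
      have h6 := mul_le_mul_of_nonneg_right hcκ (hR i hi w)
      linarith
    have h7 := sum_inter_add_sum_sdiff W ℓ wt
    linarith [hW.2]
  refine absurd (hmin _ hgood) (not_le.2 (card_lt_card ?_))
  exact ⟨sdiff_subset, fun h => (mem_sdiff.1 (h hw)).2 hwl⟩

/-- The `j`-th entry of a tuple, indexed by a natural number. -/
def entry {V : Type*} {L : ℕ} (w : Fin (L + 1) → V) (j : ℕ) : V := w (Fin.ofNat (L + 1) j)

lemma entry_update_self {V : Type*} {L : ℕ} (w : Fin (L + 1) → V) (p : ℕ) (v : V) :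
    entry (Function.update w (Fin.ofNat (L + 1) p) v) p = v := by
  simp [entry]

lemma entry_update_of_ne {V : Type*} {L : ℕ} (w : Fin (L + 1) → V) {p j : ℕ} (v : V)
    (hp : p ≤ L) (hj : j ≤ L) (h : j ≠ p) :
    entry (Function.update w (Fin.ofNat (L + 1) p) v) j = entry w j := by
  refine Function.update_of_ne (fun he => h ?_) _ _
  simpa [Fin.ext_iff, Fin.ofNat, Nat.mod_eq_of_lt (Nat.lt_succ_of_le hp),
    Nat.mod_eq_of_lt (Nat.lt_succ_of_le hj)] using he

open Finset in
lemma sum_prod_kernels_entry {V : Type*} [Fintype V] {L i : ℕ} (K : ℕ → V → V → ℝ) (hi : i ≤ L)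
    (hcol : ∀ j < i, ∀ b, ∑ a, K j a b = 1) (hrow : ∀ j, i ≤ j → ∀ a, ∑ b, K j a b = 1) :
    ∑ w : Fin (L + 1) → V, ∏ j ∈ range L, K j (entry w j) (entry w (j + 1))
      = Fintype.card V := by
  rw [← sum_prod_kernels L i K hi hcol hrow]
  refine sum_congr rfl fun w _ => ?_
  rw [← Fin.prod_univ_eq_prod_range (fun j => K j (entry w j) (entry w (j + 1)))]
  refine prod_congr rfl fun j _ => ?_
  have h1 : Fin.ofNat (L + 1) j = j.castSucc := by
    ext; simp [Fin.ofNat, Nat.mod_eq_of_lt (show (j : ℕ) < L + 1 by omega)]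
  have h2 : Fin.ofNat (L + 1) (j + 1) = j.succ := by
    ext; simp [Fin.ofNat]
  rw [entry, entry, h1, h2]

open Finset in
open scoped Classical in
/-- A graph whose minimum degree is large compared to the square root of its order has a nonempty
family of walks in which every interior vertex can be replaced in at least `s` ways. -/
lemma exists_rich_walks {V : Type*} [Fintype V] [Nonempty V] (G : SimpleGraph V) (L s : ℕ) (δ : ℝ)
    (hδ : 0 < δ) (hdeg : ∀ v, δ ≤ G.degree v) (hlarge : L * s * Fintype.card V < δ ^ 2) :
    ∃ W : Finset (Fin (L + 1) → V), W.Nonempty ∧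
      (∀ w ∈ W, ∀ j < L, G.Adj (entry w j) (entry w (j + 1))) ∧
      ∀ w ∈ W, ∀ p, 0 < p → p < L →
        s ≤ #{v | Function.update w (Fin.ofNat (L + 1) p) v ∈ W} := by
  set n : ℝ := (Fintype.card V : ℝ) with hn
  have hn0 : 0 < n := by rw [hn]; exact_mod_cast Fintype.card_pos
  let A (a b : V) : ℝ := if G.Adj a b then 1 else 0
  let g (a : V) : ℝ := (G.degree a : ℝ)⁻¹
  have hA0 : ∀ a b, 0 ≤ A a b := fun a b => by dsimp only [A]; split_ifs <;> norm_num
  have hA1 : ∀ a b, A a b ≤ 1 := fun a b => by dsimp only [A]; split_ifs <;> norm_num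
  have hdeg0 : ∀ v, (0 : ℝ) < G.degree v := fun v => hδ.trans_le (hdeg v)
  have hg0 : ∀ a, 0 ≤ g a := fun a => by positivity
  have hgδ : ∀ a, g a ≤ δ⁻¹ := fun a => inv_anti₀ hδ (hdeg a)
  have hsumA : ∀ a, ∑ b, A a b = G.degree a := by
    intro a
    simp only [A, sum_boole, ← G.card_neighborFinset_eq_degree, G.neighborFinset_eq_filter]
  have hrow : ∀ a, ∑ b, A a b * g a = 1 := fun a => by
    rw [← sum_mul, hsumA, mul_inv_cancel₀ (hdeg0 a).ne']
  have hcol : ∀ b, ∑ a, A a b * g b = 1 := fun b => by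
    rw [← hrow b]
    exact sum_congr rfl fun a _ => by simp only [A, G.adj_comm]
  let K (i j : ℕ) (a b : V) : ℝ :=
    if j + 1 < i then A a b * g b else if j ≤ i then n⁻¹ else A a b * g a
  have hK0 : ∀ i j a b, 0 ≤ K i j a b := by
    intro i j a b
    have := mul_nonneg (hA0 a b) (hg0 a)
    have := mul_nonneg (hA0 a b) (hg0 b)
    dsimp only [K]
    split_ifs <;> first | assumption | positivity
  have hconst : ∑ _a : V, n⁻¹ = 1 := by simp [← hn, hn0.ne']
  have hKcol : ∀ i, ∀ j < i, ∀ b, ∑ a, K i j a b = 1 := by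
    intro i j hj b
    by_cases h : j + 1 < i
    · simpa only [K, if_pos h] using hcol b
    · simpa only [K, if_neg h, if_pos hj.le] using hconst
  have hKrow : ∀ i, ∀ j, i ≤ j → ∀ a, ∑ b, K i j a b = 1 := by
    intro i j hj a
    by_cases h : j ≤ i
    · simpa only [K, if_neg (show ¬ j + 1 < i by omega), if_pos h] using hconst
    · simpa only [K, if_neg (show ¬ j + 1 < i by omega), if_neg h] using hrow a
  let wt (w : Fin (L + 1) → V) : ℝ :=
    ∏ j ∈ range L, A (entry w j) (entry w (j + 1)) * g (entry w j)
  let R (i : Fin (L + 1)) (w : Fin (L + 1) → V) : ℝ :=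
    ∏ j ∈ range L, K i j (entry w j) (entry w (j + 1))
  let I : Finset (Fin (L + 1)) := {i | 0 < (i : ℕ) ∧ (i : ℕ) < L}
  have hIcard : #I ≤ L := by
    have : #I < Fintype.card (Fin (L + 1)) :=
      card_lt_univ_of_notMem (x := Fin.last L) (by simp [I])
    simpa using Nat.lt_succ_iff.1 (by simpa using this)
  have hle : ∀ i ∈ I, ∀ w, wt w ≤ δ⁻¹ ^ 2 * n ^ 2 * R i w := by
    intro i hi w
    simp only [I, mem_filter, mem_univ, true_and] at hi
    obtain ⟨m, hm⟩ : ∃ m, (i : ℕ) = m + 1 := ⟨i - 1, by omega⟩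
    obtain ⟨r, hr⟩ : ∃ r, L = m + 2 + r := ⟨L - (m + 2), by omega⟩
    dsimp only [wt, R]
    generalize hx : entry w = x
    have hsplit : ∀ f : ℕ → ℝ, ∏ j ∈ range (m + 2 + r), f j
        = (∏ j ∈ range m, f j) * f m * f (m + 1) * ∏ j ∈ range r, f (m + 2 + j) := fun f => by
      rw [prod_range_add, prod_range_succ, prod_range_succ]
    rw [hm, hr, hsplit, hsplit]
    have e1 : ∏ j ∈ range m, K (m + 1) j (x j) (x (j + 1))
        = ∏ j ∈ range m, A (x j) (x (j + 1)) * g (x (j + 1)) :=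
      prod_congr rfl fun j hj => if_pos (by simpa using hj)
    have e2 : ∏ j ∈ range r, K (m + 1) (m + 2 + j) (x (m + 2 + j)) (x (m + 2 + j + 1))
        = ∏ j ∈ range r, A (x (m + 2 + j)) (x (m + 2 + j + 1)) * g (x (m + 2 + j)) :=
      prod_congr rfl fun j hj => by
        simp only [K, if_neg (show ¬ m + 2 + j + 1 < m + 1 by omega),
          if_neg (show ¬ m + 2 + j ≤ m + 1 by omega)]
    have e3 : K (m + 1) m (x m) (x (m + 1)) = n⁻¹ := by simp [K]
    have e4 : K (m + 1) (m + 1) (x (m + 1)) (x (m + 1 + 1)) = n⁻¹ := by simp [K]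
    have e5 : (∏ j ∈ range m, A (x j) (x (j + 1)) * g (x j)) * g (x m)
        = g (x 0) * ∏ j ∈ range m, A (x j) (x (j + 1)) * g (x (j + 1)) := by
      rw [prod_mul_distrib, prod_mul_distrib, mul_assoc, ← prod_range_succ (fun j => g (x j)),
        prod_range_succ' (fun j => g (x j))]
      ring
    rw [e1, e2, e3, e4]
    set P := ∏ j ∈ range m, A (x j) (x (j + 1)) * g (x (j + 1))
    set Q := ∏ j ∈ range r, A (x (m + 2 + j)) (x (m + 2 + j + 1)) * g (x (m + 2 + j))
    have hP : 0 ≤ P := prod_nonneg fun j _ => mul_nonneg (hA0 _ _) (hg0 _)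
    have hQ : 0 ≤ Q := prod_nonneg fun j _ => mul_nonneg (hA0 _ _) (hg0 _)
    have hAA : A (x m) (x (m + 1)) * A (x (m + 1)) (x (m + 1 + 1)) ≤ 1 :=
      mul_le_one₀ (hA1 _ _) (hA0 _ _) (hA1 _ _)
    have hgg : g (x 0) * g (x (m + 1)) ≤ δ⁻¹ * δ⁻¹ :=
      mul_le_mul (hgδ _) (hgδ _) (hg0 _) (by positivity)
    calc _ = ((∏ j ∈ range m, A (x j) (x (j + 1)) * g (x j)) * g (x m)) * g (x (m + 1)) *
          (A (x m) (x (m + 1)) * A (x (m + 1)) (x (m + 1 + 1))) * Q := by ring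
      _ = (g (x 0) * g (x (m + 1))) *
          (A (x m) (x (m + 1)) * A (x (m + 1)) (x (m + 1 + 1))) * (P * Q) := by rw [e5]; ring
      _ ≤ (δ⁻¹ * δ⁻¹) * 1 * (P * Q) :=
          mul_le_mul_of_nonneg_right (mul_le_mul hgg hAA (mul_nonneg (hA0 _ _) (hA0 _ _))
            (by positivity)) (mul_nonneg hP hQ)
      _ = _ := by field_simp
  have htotal : ∑ w, wt w = n :=
    sum_prod_kernels_entry (i := 0) (fun _ a b => A a b * g a) (Nat.zero_le _) (by simp)
      fun _ _ => hrow
  have hRtotal : ∀ i, ∑ w, R i w = n := fun i =>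
    sum_prod_kernels_entry (K i) (Nat.lt_succ_iff.1 i.2) (hKcol i) (hKrow i)
  obtain ⟨W, hWne, hW0, hWr⟩ := exists_rich_subset wt R I s (δ⁻¹ ^ 2 * n ^ 2)
    (s * δ⁻¹ ^ 2 * n) (by positivity) (by positivity) (le_of_eq (by rw [← hn]; ring))
    (fun i _ w => prod_nonneg fun j _ => hK0 _ _ _ _)
    (fun i hi w v => by
      simp only [I, mem_filter, mem_univ, true_and] at hi
      refine prod_congr rfl fun j hj => ?_
      have hjL : j < L := mem_range.1 hj
      have hne : ∀ k ≤ L, k ≠ i → entry (Function.update w i v) k = entry w k := fun k hk hki => by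
        simpa using entry_update_of_ne w v (show (i : ℕ) ≤ L by omega) hk hki
      by_cases h1 : j + 1 < i
      · rw [hne j (by omega) (by omega), hne (j + 1) (by omega) (by omega)]
      by_cases h2 : j ≤ i
      · simp only [K, if_neg h1, if_pos h2]
      · rw [hne j (by omega) (by omega), hne (j + 1) (by omega) (by omega)])
    hle
    (by
      simp only [hRtotal, htotal, sum_const, nsmul_eq_mul]
      calc (#I : ℝ) * (s * δ⁻¹ ^ 2 * n * n) ≤ L * (s * δ⁻¹ ^ 2 * n * n) := by gcongr
        _ = (L * s * n) / δ ^ 2 * n := by field_simp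
        _ < 1 * n := by gcongr; rwa [div_lt_one (by positivity)]
        _ = n := one_mul n)
  refine ⟨W, hWne, fun w hw j hj => ?_, fun w hw p hp0 hpL => ?_⟩
  · have h := left_ne_zero_of_mul (prod_ne_zero_iff.1 (hW0 w hw) j (mem_range.2 hj))
    by_contra hadj
    exact h (if_neg hadj)
  · refine hWr w hw _ ?_
    simp only [I, mem_filter, mem_univ, true_and, Fin.val_ofNat]
    rw [Nat.mod_eq_of_lt (by omega)]
    exact ⟨hp0, hpL⟩

open Finset in
open scoped Classical in
/-- Replacing the first `k` interior vertices of a walk one after the other by new vertices. -/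
lemma exists_sweep {V : Type*} [Fintype V] {G : SimpleGraph V} {L s : ℕ}
    {W : Finset (Fin (L + 1) → V)}
    (hadj : ∀ w ∈ W, ∀ j < L, G.Adj (entry w j) (entry w (j + 1)))
    (hrich : ∀ w ∈ W, ∀ p, 0 < p → p < L →
      s ≤ #{v | Function.update w (Fin.ofNat (L + 1) p) v ∈ W})
    {w : Fin (L + 1) → V} (hw : w ∈ W) (F : Finset V) (hF : #F + L < s) (k : ℕ) (hk : k < L) :
    ∃ w' ∈ W, (∀ p ≤ L, k < p → entry w' p = entry w p) ∧
      (∀ p, 0 < p → p ≤ k → entry w' p ∉ F ∧ G.Adj (entry w (p + 1)) (entry w' p)) ∧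
      Set.InjOn (entry w') (Set.Ioc 0 k) := by
  induction k with
  | zero => exact ⟨w, hw, fun _ _ _ => rfl, by omega, by simp⟩
  | succ k ih =>
    obtain ⟨u, hu, hufix, hunew, huinj⟩ := ih (by omega)
    obtain ⟨v, hv, hvF⟩ : ∃ v ∈ ({v | Function.update u (Fin.ofNat (L + 1) (k + 1)) v ∈ W} :
        Finset V), v ∉ F ∪ (Ioc 0 k).image (entry u) := by
      by_contra! hsub
      have h1 := card_le_card (fun v hv => hsub v hv)
      have h2 := hrich u hu (k + 1) (by omega) hk
      have h3 := card_union_le F ((Ioc 0 k).image (entry u))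
      have h4 : #((Ioc 0 k).image (entry u)) ≤ k := by simpa using card_image_le (s := Ioc 0 k)
      omega
    simp only [mem_filter, mem_univ, true_and] at hv
    simp only [mem_union, mem_image, mem_Ioc, not_or, not_exists, not_and] at hvF
    have hne : ∀ p ≤ L, p ≠ k + 1 →
        entry (Function.update u (Fin.ofNat (L + 1) (k + 1)) v) p = entry u p :=
      fun p hp hpk => entry_update_of_ne u v hk.le hp hpk
    have hself := entry_update_self u (k + 1) v
    refine ⟨_, hv, fun p hp hkp => ?_, fun p hp0 hpk => ?_, ?_⟩
    · rw [hne p hp (by omega), hufix p hp (by omega)]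
    · rcases Nat.lt_or_ge k p with h | h
      · obtain rfl : p = k + 1 := by omega
        have := hadj _ hv (k + 1) hk
        rw [hne (k + 1 + 1) (by omega) (by omega), hufix _ (by omega) (by omega)] at this
        exact ⟨by rw [hself]; exact hvF.1, this.symm⟩
      · rw [hne p (by omega) (by omega)]
        exact hunew p hp0 h
    · intro p hp q hq hpq
      simp only [Set.mem_Ioc] at hp hq
      by_cases h1 : p = k + 1 <;> by_cases h2 : q = k + 1
      · omega
      · rw [h1, hself, hne q (by omega) h2] at hpq
        exact absurd hpq.symm (hvF.2 q ⟨hq.1, by omega⟩)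
      · rw [h2, hself, hne p (by omega) h1] at hpq
        exact absurd hpq (hvF.2 p ⟨hp.1, by omega⟩)
      · rw [hne p (by omega) h1, hne q (by omega) h2] at hpq
        exact huinj ⟨hp.1, by omega⟩ ⟨hq.1, by omega⟩ hpq

open Finset in
open scoped Classical in
/-- Iterating sweeps yields many walks with disjoint interiors, consecutive ones being joined. -/
lemma exists_sweeps {V : Type*} [Fintype V] {G : SimpleGraph V} {L s : ℕ}
    {W : Finset (Fin (L + 1) → V)} (hne : W.Nonempty)
    (hadj : ∀ w ∈ W, ∀ j < L, G.Adj (entry w j) (entry w (j + 1)))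
    (hrich : ∀ w ∈ W, ∀ p, 0 < p → p < L →
      s ≤ #{v | Function.update w (Fin.ofNat (L + 1) p) v ∈ W})
    (hL : 0 < L) (m : ℕ) (hm : m * L < s) :
    ∃ u : ℕ → Fin (L + 1) → V, (∀ T, u T ∈ W) ∧
      (∀ T < m, ∀ p, 0 < p → p < L → G.Adj (entry (u T) (p + 1)) (entry (u (T + 1)) p)) ∧
      Set.InjOn (fun x : ℕ × ℕ => entry (u x.1) x.2) (Set.Ioc 0 m ×ˢ Set.Ioo 0 L) := by
  induction m with
  | zero =>
    obtain ⟨w, hw⟩ := hne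
    exact ⟨fun _ => w, fun _ => hw, by omega, by simp⟩
  | succ m ih =>
    rw [Nat.succ_mul] at hm
    obtain ⟨u, huW, hujoin, huinj⟩ := ih (by omega)
    let F : Finset V := (Ioc 0 m ×ˢ Ioo 0 L).image fun x => entry (u x.1) x.2
    have hF : #F ≤ m * L := by
      refine card_image_le.trans ?_
      rw [card_product, Nat.card_Ioc, Nat.card_Ioo]
      exact Nat.mul_le_mul (by omega) (by omega)
    obtain ⟨w, hw, -, hnew, hinj⟩ :=
      exists_sweep hadj hrich (huW m) F (by omega) (L - 1) (by omega)
    have hF' : ∀ T p q, 0 < T → T ≤ m → 0 < p → p < L → 0 < q → q < L →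
        entry (u T) p ≠ entry w q := by
      intro T p q hT0 hT hp0 hp hq0 hq h
      refine (hnew q hq0 (by omega)).1 (h ▸ mem_image.2 ⟨(T, p), ?_, rfl⟩)
      simp only [mem_product, mem_Ioc, mem_Ioo]
      omega
    have hold : ∀ T, T ≤ m → Function.update u (m + 1) w T = u T := fun T hT =>
      Function.update_of_ne (by omega) _ _
    have hlast : Function.update u (m + 1) w (m + 1) = w := Function.update_self ..
    refine ⟨Function.update u (m + 1) w, fun T => ?_, fun T hT p hp0 hp => ?_, ?_⟩
    · by_cases h : T = m + 1
      · rwa [h, hlast]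
      · rw [Function.update_of_ne h]
        exact huW T
    · rw [hold T (by omega)]
      rcases Nat.lt_or_ge T m with h | h
      · rw [hold (T + 1) h]
        exact hujoin T h p hp0 hp
      · obtain rfl : T = m := by omega
        rw [hlast]
        exact (hnew p hp0 (by omega)).2
    · rintro ⟨T, p⟩ hTp ⟨T', q⟩ hTq h
      simp only [Set.mem_prod, Set.mem_Ioc, Set.mem_Ioo] at hTp hTq
      obtain ⟨⟨hT0, hT⟩, hp0, hp⟩ := hTp
      obtain ⟨⟨hT0', hT'⟩, hq0, hq⟩ := hTq
      dsimp only at h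
      rcases hT.lt_or_eq with h1 | rfl <;> rcases hT'.lt_or_eq with h2 | rfl
      · rw [hold T (by omega), hold T' (by omega)] at h
        exact huinj ⟨⟨hT0, by omega⟩, hp0, hp⟩ ⟨⟨hT0', by omega⟩, hq0, hq⟩ h
      · rw [hold T (by omega), hlast] at h
        exact absurd h (hF' T p q hT0 (by omega) hp0 hp hq0 hq)
      · rw [hold T' (by omega), hlast] at h
        exact absurd h.symm (hF' T' q p hT0' (by omega) hq0 hq hp0 hp)
      · rw [hlast] at h
        rw [hinj ⟨hp0, by omega⟩ ⟨hq0, by omega⟩ h]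

/-- Joined walks with disjoint interiors contain a grid, embedded along the diagonals. -/
lemma contains_gridGraph_of_sweeps {V : Type*} {G : SimpleGraph V} {t : ℕ}
    {u : ℕ → Fin (2 * t + 1) → V}
    (hadj : ∀ T, ∀ j < 2 * t, G.Adj (entry (u T) j) (entry (u T) (j + 1)))
    (hjoin : ∀ T < t, ∀ p, 0 < p → p < 2 * t →
      G.Adj (entry (u T) (p + 1)) (entry (u (T + 1)) p))
    (hinj : Set.InjOn (fun x : ℕ × ℕ => entry (u x.1) x.2)
      (Set.Ioc 0 t ×ˢ Set.Ioo 0 (2 * t))) :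
    Contains G (gridGraph t) := by
  let f (x : Fin t × Fin t) : V := entry (u (x.2 + 1)) (t + x.1 - x.2)
  have hrow : ∀ (a a' b : Fin t), (a : ℕ) + 1 = a' → G.Adj (f (a, b)) (f (a', b)) := by
    intro a a' b h
    have := hadj (b + 1) (t + a - b) (by omega)
    rwa [show t + (a : ℕ) - b + 1 = t + a' - b by omega] at this
  have hcol : ∀ (a b b' : Fin t), (b : ℕ) + 1 = b' → G.Adj (f (a, b)) (f (a, b')) := by
    intro a b b' h
    have := hjoin (b + 1) (by omega) (t + a - b') (by omega) (by omega)
    rw [show t + (a : ℕ) - b' + 1 = t + a - b by omega] at this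
    simpa only [f, ← h] using this
  refine ⟨⟨f, ?_⟩, ?_⟩
  · rintro ⟨a, b⟩ ⟨a', b'⟩ h
    simp only [gridGraph, boxProd_adj, pathGraph_adj] at h
    rcases h with ⟨h | h, rfl⟩ | ⟨h | h, rfl⟩
    · exact hrow a a' b h
    · exact (hrow a' a b h).symm
    · exact hcol a b b' h
    · exact (hcol a b' b h).symm
  · rintro ⟨a, b⟩ ⟨a', b'⟩ h
    have := @hinj ((b : ℕ) + 1, t + a - b)
      ⟨⟨by simp, by simp⟩, by simp; omega, by simp; omega⟩
      ((b' : ℕ) + 1, t + a' - b')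
      ⟨⟨by simp, by simp⟩, by simp; omega, by simp; omega⟩ h
    simp only [Prod.mk.injEq] at this
    ext <;> simp only <;> omega

open Finset in
open scoped Classical in
/-- A graph with more than `c` edges per vertex has a nonempty induced subgraph with minimum degree
more than `c`. -/
lemma exists_lt_degree_induce {V : Type*} [Fintype V] (G : SimpleGraph V) (c : ℝ)
    (h : c * Fintype.card V < G.edgeSet.ncard) :
    ∃ S : Finset V, S.Nonempty ∧ ∀ v : S, c < (G.induce (S : Set V)).degree v := by
  let A (a b : V) : ℝ := if G.Adj a b then 1 else 0
  let Dense (S : Finset V) : Prop := 2 * c * #S < ∑ a ∈ S, ∑ b ∈ S, A a b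
  have hdense : Dense univ := by
    have h1 : ∑ a, ∑ b, A a b = 2 * G.edgeSet.ncard := by
      rw [Set.ncard_eq_toFinset_card', Set.toFinset_card, ← G.edgeFinset_card]
      have := G.sum_degrees_eq_twice_card_edges
      rw [← Nat.cast_ofNat, ← Nat.cast_mul, ← this, Nat.cast_sum]
      refine sum_congr rfl fun a _ => ?_
      simp only [A, sum_boole, ← G.card_neighborFinset_eq_degree, G.neighborFinset_eq_filter]
    simp only [Dense, h1, card_univ]
    linarith
  obtain ⟨S, hS, hmin⟩ := exists_min_image (univ.filter Dense) card ⟨univ, by simpa using hdense⟩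
  replace hS : Dense S := by simpa using hS
  replace hmin : ∀ S', Dense S' → #S ≤ #S' := fun S' h => hmin S' (by simpa using h)
  refine ⟨S, ?_, fun ⟨v, hv⟩ => ?_⟩
  · rw [nonempty_iff_ne_empty]
    rintro rfl
    simp [Dense] at hS
  have hdeg : ((G.induce (S : Set V)).degree ⟨v, hv⟩ : ℝ) = ∑ b ∈ S, A v b := by
    rw [← SimpleGraph.card_neighborFinset_eq_degree, SimpleGraph.neighborFinset_eq_filter]
    simp only [comap_adj, Function.Embedding.subtype_apply, A]
    rw [← sum_coe_sort S, sum_boole]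
    congr!
  rw [hdeg]
  by_contra! hle
  have hsymm : ∀ a b, A a b = A b a := fun a b => by simp only [A, G.adj_comm]
  have hself : A v v = 0 := by simp [A]
  have h1 : ∑ a ∈ S, ∑ b ∈ S, A a b
      = ∑ a ∈ S.erase v, ∑ b ∈ S.erase v, A a b + 2 * ∑ b ∈ S, A v b := by
    have h2 : ∀ a, ∑ b ∈ S, A a b = A a v + ∑ b ∈ S.erase v, A a b := fun a =>
      (add_sum_erase S _ hv).symm
    rw [← add_sum_erase S _ hv, sum_congr rfl fun a _ => h2 a, sum_add_distrib, h2 v, hself,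
      sum_congr rfl fun a _ => hsymm a v]
    ring
  have hcard : (#(S.erase v) : ℝ) = #S - 1 := by
    rw [card_erase_of_mem hv, Nat.cast_pred (card_pos.2 ⟨v, hv⟩)]
  refine absurd (hmin (S.erase v) ?_) (not_le.2 (card_erase_lt_of_mem hv))
  simp only [Dense, hcard] at hS ⊢
  linarith

/-- For every `t ≥ 2` there is `C = C(t) > 0` such that `ex(n, F_t) ≤ C · n^{3/2}`:
every graph on `n ≥ 1` vertices with more than `C · n^{3/2}` edges contains `F_t`. -/
theorem turan_grid_upper (t : ℕ) (ht : 2 ≤ t) :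
    ∃ C : ℝ, 0 < C ∧ ∀ (n : ℕ), 0 < n → ∀ (V : Type) (_ : Fintype V),
      Fintype.card V = n → ∀ G : SimpleGraph V,
        C * (n : ℝ) ^ ((3 : ℝ) / 2) < (G.edgeSet.ncard : ℝ) →
          Contains G (gridGraph t) := by
  classical
  refine ⟨2 * t ^ 2, by positivity, fun n hn V _ hV G hG => ?_⟩
  have hn0 : (0 : ℝ) < n := by exact_mod_cast hn
  have hpow : (n : ℝ) ^ ((3 : ℝ) / 2) = √n * n := by
    rw [show (3 : ℝ) / 2 = 1 / 2 + 1 by norm_num, Real.rpow_add_one hn0.ne', Real.sqrt_eq_rpow]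
  obtain ⟨S, hS, hdeg⟩ := exists_lt_degree_induce G (2 * t ^ 2 * √n) (by
    rw [hV, mul_assoc, ← hpow]; exact hG)
  have : Nonempty (S : Set V) := hS.to_subtype
  obtain ⟨W, hWne, hadj, hrich⟩ := exists_rich_walks (G.induce (S : Set V)) (2 * t) (t * (2 * t) + 1)
    (2 * t ^ 2 * √n) (by positivity) (fun v => (hdeg v).le.trans_eq (by congr!)) (by
      have hle : ∀ _ : Fintype (S : Set V), Fintype.card (S : Set V) ≤ n := fun _ => by
        rw [← hV]
        exact Fintype.card_le_of_injective _ Subtype.val_injective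
      have ht' : (2 : ℝ) ≤ t := by exact_mod_cast ht
      have hconst : 2 * (t : ℝ) * (t * (2 * t) + 1) < (2 * t ^ 2) ^ 2 := by
        nlinarith [mul_nonneg (sub_nonneg.2 ht') (pow_nonneg (zero_le_two.trans ht') 3),
          pow_pos (zero_lt_two.trans_le ht') 3]
      rw [mul_pow, Real.sq_sqrt hn0.le]
      push_cast
      calc _ ≤ 2 * (t : ℝ) * (t * (2 * t) + 1) * n := by gcongr; exact hle _
        _ < _ := by gcongr)
  obtain ⟨u, huW, hjoin, hinj⟩ := exists_sweeps hWne hadj hrich (by omega) t (by omega)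
  obtain ⟨f, hf⟩ := contains_gridGraph_of_sweeps (fun T => hadj _ (huW T)) hjoin hinj
  exact ⟨(Embedding.induce (S : Set V)).toHom.comp f, Subtype.val_injective.comp hf⟩
end

section
/- For every finite tree T with at least one edge and every path P with at least one edge, there exists a positive real constant C such that for every positive integer n, ex(n, T □ P) ≤ C·n^{3/2}, where T □ P denotes the Cartesian product of T and P. That is, every simple graph on n vertices with more than C·n^{3/2} edges contains a subgraph isomorphic to T □ P. -/
open SimpleGraph

/-- Summing a chain of kernels with constant row sums. -/
theorem sum_prod_chain {V : Type*} [Fintype V] (k : ℕ) (M : Fin k → V → V → ℝ) (s : Fin k → ℝ)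
    (hM : ∀ j u, ∑ v, M j u v = s j) :
    ∑ f : Fin (k + 1) → V, ∏ j, M j (f j.castSucc) (f j.succ) = Fintype.card V * ∏ j, s j := by
  induction k with
  | zero => simp
  | succ k ih =>
    rw [← (Fin.snocEquiv (fun _ : Fin (k + 1 + 1) => V)).sum_comp, Fintype.sum_prod_type_right,
      Fin.prod_univ_castSucc, ← mul_assoc,
      ← ih (fun j => M j.castSucc) (fun j => s j.castSucc) (fun j u => hM _ u), Finset.sum_mul]
    refine Finset.sum_congr rfl fun g _ => ?_
    rw [← hM (Fin.last k) (g (Fin.last k)), Finset.mul_sum]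
    refine Finset.sum_congr rfl fun v _ => ?_
    rw [Fin.prod_univ_castSucc]
    simp only [Fin.snocEquiv, Equiv.coe_fn_mk, Fin.succ_castSucc, Fin.succ_last, Fin.snoc_castSucc,
      Fin.snoc_last]

/-- Resampling one coordinate averages over its fibres. -/
theorem sum_sum_update {ι V : Type*} [Fintype ι] [DecidableEq ι] [Fintype V]
    (i : ι) (h : (ι → V) → ℝ) :
    ∑ f : ι → V, ∑ w, h (Function.update f i w) = Fintype.card V * ∑ f, h f := by
  have hinv : Function.Involutive
      (fun x : (ι → V) × V => (Function.update x.1 i x.2, x.1 i)) := by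
    rintro ⟨f, w⟩
    simp
  have := Equiv.sum_comp hinv.toPerm (fun x : (ι → V) × V => h x.1)
  rw [Fintype.sum_prod_type, Fintype.sum_prod_type] at this
  simpa [Finset.mul_sum] using this

/-- Extension of a finite sequence to all of `ℕ` by a default value. -/
def extendSeq {V : Type*} (v₀ : V) {m : ℕ} (f : Fin m → V) (j : ℕ) : V :=
  if h : j < m then f ⟨j, h⟩ else v₀

theorem extendSeq_update {V : Type*} (v₀ : V) {m : ℕ} (f : Fin m → V) (i : Fin m) (w : V) :
    extendSeq v₀ (Function.update f i w) = Function.update (extendSeq v₀ f) i w := by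
  funext j
  by_cases hj : j < m
  · by_cases hji : j = i
    · subst hji; simp [extendSeq]
    · have : (⟨j, hj⟩ : Fin m) ≠ i := fun h => hji (by rw [← h])
      simp [extendSeq, hj, hji, this]
  · have : j ≠ i := by omega
    simp [extendSeq, hj, this]

/-- The transition probabilities of the simple random walk on `G`. -/
noncomputable def stepProb {V : Type*} [Fintype V] (G : SimpleGraph V) (u v : V) : ℝ := by
  classical exact if G.Adj u v then (G.degree u : ℝ)⁻¹ else 0

/-- The weight of a sequence under the simple random walk on `G`. -/
noncomputable def walkWeight {V : Type*} [Fintype V] (G : SimpleGraph V) {k : ℕ}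
    (f : Fin (k + 1) → V) : ℝ :=
  ∏ j : Fin k, stepProb G (f j.castSucc) (f j.succ)

/-- The first `k` steps of `g` form a walk in `G`. -/
def IsWalkSeq {V : Type*} (G : SimpleGraph V) (k : ℕ) (g : ℕ → V) : Prop :=
  ∀ j < k, G.Adj (g j) (g (j + 1))

/-- Any inner vertex of the walk `g` can be replaced while avoiding any `N` given vertices, and
this can be repeated `r` times. -/
def FlipRich {V : Type*} (G : SimpleGraph V) (k N : ℕ) : ℕ → (ℕ → V) → Prop
  | 0, g => IsWalkSeq G k g
  | r + 1, g => IsWalkSeq G k g ∧ ∀ a, a + 1 < k → ∀ F : Finset V, F.card ≤ N →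
      ∃ w ∉ F, FlipRich G k N r (Function.update g (a + 1) w)

theorem FlipRich.isWalkSeq {V : Type*} {G : SimpleGraph V} {k N r : ℕ} {g : ℕ → V}
    (h : FlipRich G k N r g) : IsWalkSeq G k g := by
  cases r with
  | zero => exact h
  | succ r => exact h.1

section Weights

variable {V : Type*} [Fintype V] {G : SimpleGraph V}

theorem stepProb_nonneg (u v : V) : 0 ≤ stepProb G u v := by
  unfold stepProb
  split_ifs <;> positivity

open Classical in
theorem stepProb_le {δ : ℝ} (hδ : 0 < δ) (hdeg : ∀ v, δ ≤ G.degree v) (u v : V) :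
    stepProb G u v ≤ δ⁻¹ := by
  unfold stepProb
  split_ifs
  · exact inv_anti₀ hδ (by convert hdeg u)
  · positivity

open Classical in
theorem sum_stepProb {δ : ℝ} (hδ : 0 < δ) (hdeg : ∀ v, δ ≤ G.degree v) (u : V) :
    ∑ v, stepProb G u v = 1 := by
  have hu : (G.degree u : ℝ) ≠ 0 := (hδ.trans_le (hdeg u)).ne'
  unfold stepProb
  rw [← Finset.sum_filter, Finset.sum_const, ← G.neighborFinset_eq_filter,
    G.card_neighborFinset_eq_degree, nsmul_eq_mul]
  convert mul_inv_cancel₀ hu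

theorem walkWeight_nonneg {k : ℕ} (f : Fin (k + 1) → V) : 0 ≤ walkWeight G f :=
  Finset.prod_nonneg fun _ _ => stepProb_nonneg _ _

open Classical in
theorem sum_walkWeight {δ : ℝ} (hδ : 0 < δ) (hdeg : ∀ v, δ ≤ G.degree v) (k : ℕ) :
    ∑ f : Fin (k + 1) → V, walkWeight G f = Fintype.card V := by
  unfold walkWeight
  rw [sum_prod_chain k (fun _ => stepProb G) (fun _ => 1) fun _ u => sum_stepProb hδ hdeg u]
  simp

theorem walkWeight_eq_zero (v₀ : V) {k : ℕ} (f : Fin (k + 1) → V)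
    (hf : ¬ IsWalkSeq G k (extendSeq v₀ f)) : walkWeight G f = 0 := by
  unfold IsWalkSeq at hf
  push Not at hf
  obtain ⟨j, hj, hadj⟩ := hf
  refine Finset.prod_eq_zero (Finset.mem_univ ⟨j, hj⟩) ?_
  have h1 : j < k + 1 := by omega
  rw [extendSeq, extendSeq, dif_pos h1, dif_pos (by omega)] at hadj
  unfold stepProb
  exact if_neg hadj

/-- An upper bound for `walkWeight` that does not depend on the coordinate `a + 1`. -/
noncomputable def fibreBound (G : SimpleGraph V) (δ : ℝ) (a : ℕ) {k : ℕ}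
    (f : Fin (k + 1) → V) : ℝ :=
  ∏ j : Fin k, if (j : ℕ) = a ∨ (j : ℕ) = a + 1 then δ⁻¹
    else stepProb G (f j.castSucc) (f j.succ)

open Classical in
theorem walkWeight_update_le {δ : ℝ} (hδ : 0 < δ) (hdeg : ∀ v, δ ≤ G.degree v) {k a : ℕ}
    (ha : a + 1 < k) (f : Fin (k + 1) → V) (w : V) :
    walkWeight G (Function.update f ⟨a + 1, by omega⟩ w) ≤ fibreBound G δ a f := by
  refine Finset.prod_le_prod (fun _ _ => stepProb_nonneg _ _) fun j _ => ?_
  split_ifs with h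
  · exact stepProb_le hδ hdeg _ _
  · push Not at h
    rw [Function.update_of_ne, Function.update_of_ne]
    · simp only [ne_eq, Fin.ext_iff, Fin.val_succ]; omega
    · simp only [ne_eq, Fin.ext_iff, Fin.val_castSucc]; omega

open Classical in
theorem sum_fibreBound {δ : ℝ} (hδ : 0 < δ) (hdeg : ∀ v, δ ≤ G.degree v) {k a : ℕ}
    (ha : a + 1 < k) :
    ∑ f : Fin (k + 1) → V, fibreBound G δ a f =
      Fintype.card V * (Fintype.card V * δ⁻¹) ^ 2 := by
  unfold fibreBound
  rw [sum_prod_chain k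
    (fun j u v => if (j : ℕ) = a ∨ (j : ℕ) = a + 1 then δ⁻¹ else stepProb G u v)
    (fun j => if (j : ℕ) = a ∨ (j : ℕ) = a + 1 then Fintype.card V * δ⁻¹ else 1)]
  · have hfil : (Finset.univ.filter fun j : Fin k => (j : ℕ) = a ∨ (j : ℕ) = a + 1) =
        {⟨a, by omega⟩, ⟨a + 1, ha⟩} := by
      ext j
      simp [Fin.ext_iff]
    rw [Finset.prod_ite, hfil]
    simp [Fin.ext_iff, sq]
  · intro j u
    by_cases h : (j : ℕ) = a ∨ (j : ℕ) = a + 1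
    · simp [h]
    · simp [h, sum_stepProb hδ hdeg u]

/-- The constants in the bound for the weight of the walks that are not flip-rich. -/
def flipConst (k N : ℕ) : ℕ → ℕ
  | 0 => 0
  | r + 1 => k * (flipConst k N r + N)

open Classical in
theorem sum_not_flipRich_le {δ : ℝ} (hδ : 0 < δ) (hdeg : ∀ v, δ ≤ G.degree v) (v₀ : V)
    (k N r : ℕ) :
    ∑ f : Fin (k + 1) → V, (if FlipRich G k N r (extendSeq v₀ f) then 0 else walkWeight G f) ≤
      flipConst k N r * (Fintype.card V * δ⁻¹) ^ 2 := by
  induction r with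
  | zero =>
    rw [Finset.sum_eq_zero]
    · simp [flipConst]
    · intro f _
      split_ifs with h
      · rfl
      · exact walkWeight_eq_zero v₀ f h
  | succ r ih =>
    set n : ℝ := (Fintype.card V : ℝ) with hn
    have hn0 : 0 < n := by
      exact Nat.cast_pos.2 (Fintype.card_pos_iff.2 ⟨v₀⟩)
    let stuck (a : ℕ) (g : ℕ → V) : Prop := ∃ F : Finset V, F.card ≤ N ∧
      ∀ w ∉ F, ¬ FlipRich G k N r (Function.update g (a + 1) w)
    let bad (f : Fin (k + 1) → V) : ℝ :=
      if FlipRich G k N r (extendSeq v₀ f) then 0 else walkWeight G f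
    have hbad (f) : 0 ≤ bad f := by
      simp only [bad]; split_ifs
      · exact le_rfl
      · exact walkWeight_nonneg f
    have hstuck (a : ℕ) (ha : a + 1 < k) :
        ∑ f : Fin (k + 1) → V, (if stuck a (extendSeq v₀ f) then walkWeight G f else 0) ≤
          (flipConst k N r + N) * (n * δ⁻¹) ^ 2 := by
      have hi : a + 1 < k + 1 := by omega
      refine le_of_mul_le_mul_left ?_ hn0
      rw [hn, ← sum_sum_update ⟨a + 1, hi⟩]
      calc _ ≤ ∑ f : Fin (k + 1) → V, (∑ w, bad (Function.update f ⟨a + 1, hi⟩ w)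
            + N * fibreBound G δ a f) := ?_
        _ = n * ∑ f, bad f + N * (n * (n * δ⁻¹) ^ 2) := by
            rw [Finset.sum_add_distrib, sum_sum_update, ← Finset.mul_sum,
              sum_fibreBound hδ hdeg ha]
        _ ≤ n * (flipConst k N r * (n * δ⁻¹) ^ 2) + N * (n * (n * δ⁻¹) ^ 2) := by
            gcongr
        _ = _ := by ring
      refine Finset.sum_le_sum fun f _ => ?_
      have hfb : 0 ≤ fibreBound G δ a f :=
        (walkWeight_nonneg _).trans (walkWeight_update_le hδ hdeg ha f v₀)
      have hiff (w : V) : stuck a (extendSeq v₀ (Function.update f ⟨a + 1, hi⟩ w)) ↔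
          stuck a (extendSeq v₀ f) := by
        simp only [stuck, extendSeq_update, Function.update_idem]
      simp only [hiff]
      by_cases hs : stuck a (extendSeq v₀ f)
      · simp only [hs, if_true]
        obtain ⟨F, hF, hw⟩ := hs
        calc _ ≤ ∑ w, (bad (Function.update f ⟨a + 1, hi⟩ w) +
              if w ∈ F then fibreBound G δ a f else 0) := by
              refine Finset.sum_le_sum fun w _ => ?_
              by_cases hwF : w ∈ F
              · simp only [hwF, if_true]
                linarith [hbad (Function.update f ⟨a + 1, hi⟩ w),
                  walkWeight_update_le hδ hdeg ha f w]
              · have := hw w hwF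
                simp only [bad, extendSeq_update, this, hwF, if_false, add_zero, le_refl]
          _ ≤ _ := by
              rw [Finset.sum_add_distrib, Finset.sum_ite_mem, Finset.univ_inter,
                Finset.sum_const, nsmul_eq_mul]
              gcongr
      · simp only [hs, if_false, Finset.sum_const_zero]
        exact add_nonneg (Finset.sum_nonneg fun _ _ => hbad _) (by positivity)
    calc _ ≤ ∑ f : Fin (k + 1) → V, ∑ a ∈ Finset.range (k - 1),
          (if stuck a (extendSeq v₀ f) then walkWeight G f else 0) := ?_
      _ = ∑ a ∈ Finset.range (k - 1), ∑ f : Fin (k + 1) → V,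
          (if stuck a (extendSeq v₀ f) then walkWeight G f else 0) := Finset.sum_comm
      _ ≤ ∑ a ∈ Finset.range (k - 1), (flipConst k N r + N) * (n * δ⁻¹) ^ 2 :=
          Finset.sum_le_sum fun a ha => hstuck a (by have := Finset.mem_range.1 ha; omega)
      _ ≤ _ := by
          rw [Finset.sum_const, Finset.card_range, nsmul_eq_mul, flipConst]
          push_cast
          rw [← mul_assoc]
          gcongr
          omega
    refine Finset.sum_le_sum fun f _ => ?_
    have hterm (a : ℕ) : 0 ≤ if stuck a (extendSeq v₀ f) then walkWeight G f else 0 := by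
      split_ifs
      · exact walkWeight_nonneg f
      · exact le_rfl
    split_ifs with h
    · exact Finset.sum_nonneg fun a _ => hterm a
    · by_cases hwalk : IsWalkSeq G k (extendSeq v₀ f)
      · simp only [FlipRich, hwalk, true_and] at h
        push Not at h
        obtain ⟨a, ha, F, hF, hw⟩ := h
        have hs : stuck a (extendSeq v₀ f) := ⟨F, hF, hw⟩
        refine le_trans ?_ (Finset.single_le_sum (fun a _ => hterm a)
          (Finset.mem_range.2 (by omega : a < k - 1)))
        simp [hs]
      · rw [walkWeight_eq_zero v₀ f hwalk]
        exact Finset.sum_nonneg fun a _ => by simp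

open Classical in
theorem exists_flipRich [Nonempty V] {δ : ℝ} (hδ : 0 < δ) (hdeg : ∀ v, δ ≤ G.degree v) (k N r : ℕ)
    (hbig : flipConst k N r * Fintype.card V < δ ^ 2) : ∃ g, FlipRich G k N r g := by
  obtain ⟨v₀⟩ := ‹Nonempty V›
  by_contra! hno
  have hle := sum_not_flipRich_le hδ hdeg v₀ k N r
  simp only [hno, if_false] at hle
  rw [sum_walkWeight hδ hdeg] at hle
  have hn0 : (0 : ℝ) < Fintype.card V := by
    have : 0 < Fintype.card V := Fintype.card_pos_iff.2 ⟨v₀⟩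
    exact_mod_cast this
  rw [mul_pow, inv_pow, ← mul_assoc, ← div_eq_mul_inv, le_div_iff₀ (by positivity)] at hle
  nlinarith

end Weights

/-- In a flip-rich walk, the segment at positions `h, …, h + t - 1` has a parallel copy
at positions `h + 1, …, h + t` of another flip-rich walk, with new vertices. -/
theorem FlipRich.exists_parallel {V : Type*} {G : SimpleGraph V} {k N h t : ℕ} (ht : h + t < k)
    (F : Finset V) (hF : F.card + (k + 1) ≤ N) :
    ∀ s ≤ t, ∀ r g, FlipRich G k N (r + s) g → ∃ g', FlipRich G k N r g' ∧
      (∀ q ≤ h + t - s, g' q = g q) ∧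
      (∀ q, h + t - s < q → q ≤ h + t → g' q ∉ F) ∧
      (∀ q q', h + t - s < q → q ≤ h + t → h + t - s < q' → q' ≤ h + t →
        g' q = g' q' → q = q') ∧
      (∀ q, h + t - s ≤ q → q < h + t → G.Adj (g q) (g' (q + 1))) := by
  classical
  intro s
  induction s with
  | zero =>
    intro _ r g hg
    exact ⟨g, hg, fun _ _ => rfl, fun q _ _ => by omega, fun q _ _ _ => by omega,
      fun q _ _ => by omega⟩
  | succ s ih =>
    intro hs r g hg
    obtain ⟨g', hg', heq, hav, hinj, hadj⟩ :=
      ih (by omega) (r + 1) g (by convert hg using 1; omega)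
    obtain ⟨a, haa⟩ : ∃ a, h + t - s = a + 1 := ⟨h + t - s - 1, by omega⟩
    have ha' : h + t - (s + 1) = a := by omega
    rw [haa] at heq hav hinj hadj
    obtain ⟨w, hw, hrich⟩ := hg'.2 a (by omega) (F ∪ (Finset.range (k + 1)).image g') <| by
      refine (Finset.card_union_le _ _).trans (le_trans ?_ hF)
      gcongr
      exact Finset.card_image_le.trans (by simp)
    simp only [Finset.mem_union, Finset.mem_image, Finset.mem_range, not_or, not_exists,
      not_and] at hw
    rw [ha']
    refine ⟨_, hrich, fun q hq => ?_, fun q hq hq' => ?_, fun q q' h1 h2 h3 h4 h5 => ?_,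
      fun q h1 h2 => ?_⟩
    · rw [Function.update_of_ne (by omega), heq q (by omega)]
    · by_cases hqa : q = a + 1
      · subst hqa; simpa using hw.1
      · rw [Function.update_of_ne hqa]; exact hav q (by omega) hq'
    · by_cases hqa : q = a + 1 <;> by_cases hqa' : q' = a + 1
      · omega
      · subst hqa
        rw [Function.update_self, Function.update_of_ne hqa'] at h5
        exact absurd h5.symm (hw.2 q' (by omega))
      · subst hqa'
        rw [Function.update_self, Function.update_of_ne hqa] at h5
        exact absurd h5 (hw.2 q (by omega))
      · rw [Function.update_of_ne hqa, Function.update_of_ne hqa'] at h5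
        exact hinj q q' (by omega) h2 (by omega) h4 h5
    · by_cases hqa : q = a
      · subst hqa
        have := hrich.isWalkSeq q (by omega)
        rwa [Function.update_of_ne (by omega), heq q (by omega)] at this
      · rw [Function.update_of_ne (by omega)]
        exact hadj q (by omega) h2

open Classical in
/-- A flip-rich walk gives a family of pairwise disjoint paths indexed by a tree, such that the
paths at adjacent vertices of the tree are parallel. -/
theorem FlipRich.exists_tree_family {V : Type*} {G : SimpleGraph V} {k N D t : ℕ} (hk : D + t ≤ k)
    (hN : D * t + (k + 1) ≤ N) {g₀ : ℕ → V} (hg₀ : FlipRich G k N (D * t) g₀)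
    (m : ℕ) (hm : m ≤ D) :
    ∀ (W : Type) [Fintype W] (T : SimpleGraph W), T.IsTree → Fintype.card W = m →
      ∃ (g : W → ℕ → V) (h : W → ℕ), (∀ v, h v < m) ∧
        (∀ v, FlipRich G k N ((D - (h v + 1)) * t) (g v)) ∧
        (∀ v v' j j', j < t → j' < t → g v (h v + 1 + j) = g v' (h v' + 1 + j') →
          v = v' ∧ j = j') ∧
        (∀ v v', T.Adj v v' → ∀ j < t, G.Adj (g v (h v + 1 + j)) (g v' (h v' + 1 + j))) := by
  induction m with
  | zero =>
    intro W _ T hT hW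
    have := hT.connected.nonempty
    exact absurd hW Fintype.card_ne_zero
  | succ m ih =>
    intro W _ T hT hW
    rcases Nat.eq_zero_or_pos m with rfl | hmpos
    · have hsub : Subsingleton W := Fintype.card_le_one_iff_subsingleton.1 hW.le
      obtain ⟨g, hg, -, -, hinj, -⟩ := FlipRich.exists_parallel (G := G) (k := k) (N := N)
        (h := 0) (t := t) (by omega) ∅ (by rw [Finset.card_empty]; omega) t le_rfl ((D - 1) * t) g₀ (by
          convert hg₀ using 1
          obtain ⟨d, rfl⟩ : ∃ d, D = d + 1 := ⟨D - 1, by omega⟩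
          simp [Nat.succ_mul])
      refine ⟨fun _ => g, fun _ => 0, fun _ => one_pos, fun _ => hg, fun v v' j j' hj hj' h => ?_,
        fun v v' hadj => ?_⟩
      · have := hinj (0 + 1 + j) (0 + 1 + j') (by omega) (by omega) (by omega) (by omega) h
        exact ⟨Subsingleton.elim _ _, by omega⟩
      · exact absurd (Subsingleton.elim v v') hadj.ne
    · have hnt : Nontrivial W := Fintype.one_lt_card_iff_nontrivial.1 (by omega)
      obtain ⟨c, hc⟩ := hT.exists_vert_degree_one_of_nontrivial
      have hT' : (T.induce {c}ᶜ).IsTree :=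
        ⟨hT.connected.induce_compl_singleton_of_degree_eq_one hc, hT.isAcyclic.induce _⟩
      have hW' : Fintype.card ({c}ᶜ : Set W) = m := by
        rw [Fintype.card_compl_set, hW]; simp
      obtain ⟨g, h, hlt, hrich, hinj, hadj⟩ := ih (by omega) _ (T.induce {c}ᶜ) hT' hW'
      obtain ⟨p, hp, hpu⟩ := T.degree_eq_one_iff_existsUnique_adj.1 hc
      set p' : ({c}ᶜ : Set W) := ⟨p, hp.ne'⟩
      have hltp := hlt p'
      obtain ⟨gc, hgc, -, hnew, hcinj, hcadj⟩ := FlipRich.exists_parallel (G := G) (k := k) (N := N)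
        (h := h p' + 1) (t := t) (by omega)
        ((Finset.univ : Finset (({c}ᶜ : Set W) × Fin t)).image
          fun x => g x.1 (h x.1 + 1 + x.2)) (by
            refine le_trans ?_ hN
            gcongr
            refine Finset.card_image_le.trans ?_
            rw [Finset.card_univ, Fintype.card_prod, hW', Fintype.card_fin]
            gcongr
            omega) t le_rfl ((D - (h p' + 1 + 1)) * t) (g p') (by
            convert hrich p' using 1
            obtain ⟨d, hd⟩ : ∃ d, D = h p' + 1 + 1 + d := ⟨D - (h p' + 1 + 1), by omega⟩
            rw [show D - (h p' + 1 + 1) = d by omega, show D - (h p' + 1) = d + 1 by omega,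
              Nat.succ_mul])
      rw [Nat.add_sub_cancel] at hnew hcinj hcadj
      have hnew' (v : ({c}ᶜ : Set W)) (j j' : ℕ) (hj : j < t) (hj' : j' < t) :
          gc (h p' + 1 + 1 + j) ≠ g v (h v + 1 + j') := fun heq =>
        hnew (h p' + 1 + 1 + j) (by omega) (by omega)
          (Finset.mem_image.2 ⟨(v, ⟨j', hj'⟩), Finset.mem_univ _, heq.symm⟩)
      have hpar (v : W) (hv : T.Adj c v) (hvc : v ≠ c) (j : ℕ) (hj : j < t) :
          G.Adj (g ⟨v, hvc⟩ (h ⟨v, hvc⟩ + 1 + j)) (gc (h p' + 1 + 1 + j)) := by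
        obtain rfl := hpu v hv
        convert hcadj (h p' + 1 + j) (by omega) (by omega) using 2
        omega
      refine ⟨fun v => if hv : v = c then gc else g ⟨v, hv⟩,
        fun v => if hv : v = c then h p' + 1 else h ⟨v, hv⟩, fun v => ?_, fun v => ?_,
        fun v v' j j' hj hj' heq => ?_, fun v v' hvv j hj => ?_⟩
      · by_cases hv : v = c
        · simp only [hv, dite_true]; omega
        · simp only [hv, dite_false]; exact (hlt _).trans (by omega)
      · by_cases hv : v = c
        · simp only [hv, dite_true]; exact hgc
        · simp only [hv, dite_false]; exact hrich _
      · by_cases hv : v = c <;> by_cases hv' : v' = c <;>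
          simp only [hv, hv', dite_true, dite_false] at heq
        · have := hcinj _ _ (by omega) (by omega) (by omega) (by omega) heq
          exact ⟨hv.trans hv'.symm, by omega⟩
        · exact absurd heq (hnew' _ _ _ hj hj')
        · exact absurd heq.symm (hnew' _ _ _ hj' hj)
        · obtain ⟨h1, h2⟩ := hinj _ _ _ _ hj hj' heq
          exact ⟨congrArg Subtype.val h1, h2⟩
      · by_cases hv : v = c <;> by_cases hv' : v' = c <;>
          simp only [hv, hv', dite_true, dite_false]
        · exact absurd (hv.trans hv'.symm) hvv.ne
        · exact (hpar v' (hv ▸ hvv) hv' j hj).symm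
        · exact hpar v (hv' ▸ hvv.symm) hv j hj
        · exact hadj ⟨v, hv⟩ ⟨v', hv'⟩ hvv j hj

theorem FlipRich.contains {V W : Type} [Fintype W] {G : SimpleGraph V} {T : SimpleGraph W}
    (hT : T.IsTree) {k N t : ℕ} (hk : Fintype.card W + t ≤ k)
    (hN : Fintype.card W * t + (k + 1) ≤ N) {g₀ : ℕ → V}
    (hg₀ : FlipRich G k N (Fintype.card W * t) g₀) : Contains G (T.boxProd (pathGraph t)) := by
  obtain ⟨g, h, hlt, hrich, hinj, hadj⟩ := hg₀.exists_tree_family hk hN _ le_rfl W T hT rfl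
  have hwalk (v : W) (j : ℕ) (hj : j + 1 < t) :
      G.Adj (g v (h v + 1 + j)) (g v (h v + 1 + (j + 1))) :=
    (hrich v).isWalkSeq (h v + 1 + j) (by have := hlt v; omega)
  refine ⟨⟨fun x => g x.1 (h x.1 + 1 + x.2), ?_⟩, ?_⟩
  · rintro ⟨v, j⟩ ⟨v', j'⟩ hx
    rw [boxProd_adj, pathGraph_adj] at hx
    rcases hx with ⟨hv, rfl⟩ | ⟨hj | hj, rfl⟩
    · exact hadj _ _ hv _ j.2
    · have := hwalk v j (hj.trans_lt j'.2)
      rwa [hj] at this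
    · have := hwalk v j' (hj.trans_lt j.2)
      rw [hj] at this
      exact this.symm
  · rintro ⟨v, j⟩ ⟨v', j'⟩ hx
    obtain ⟨h1, h2⟩ := hinj v v' j j' j.2 j'.2 hx
    exact Prod.ext h1 (Fin.ext h2)

theorem Contains.of_induce {α β : Type*} {G : SimpleGraph α} {H : SimpleGraph β} {s : Set α}
    (h : Contains (G.induce s) H) : Contains G H := by
  obtain ⟨f, hf⟩ := h
  exact ⟨(Embedding.induce s).toHom.comp f, Subtype.val_injective.comp hf⟩

open Classical in
/-- To find `H` in graphs of large average degree it suffices to find it in graphs of large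
minimum degree. -/
theorem contains_of_card_edgeFinset {β : Type*} {H : SimpleGraph β} {n₀ : ℕ} {δ : ℝ}
    (hmin : ∀ (V : Type) [Fintype V] [Nonempty V] (G : SimpleGraph V), Fintype.card V ≤ n₀ →
      (∀ v, δ ≤ G.degree v) → Contains G H) (n : ℕ) (hn : n ≤ n₀) :
    ∀ (V : Type) [Fintype V] (G : SimpleGraph V), Fintype.card V = n →
      δ * n < G.edgeFinset.card → Contains G H := by
  induction n with
  | zero =>
    intro V _ G hV hG
    have : IsEmpty V := Fintype.card_eq_zero_iff.1 hV
    have : G.edgeFinset = ∅ := by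
      rw [edgeFinset_eq_empty]; exact Subsingleton.elim _ _
    simp [this] at hG
  | succ n ih =>
    intro V _ G hV hG
    have hne : Nonempty V := Fintype.card_pos_iff.1 (by omega)
    by_cases hdeg : ∀ v, δ ≤ G.degree v
    · exact hmin V G (by omega) hdeg
    · push Not at hdeg
      obtain ⟨v, hv⟩ := hdeg
      refine Contains.of_induce (s := {v}ᶜ) (ih (by omega) _ _ ?_ ?_)
      · rw [Fintype.card_compl_set, hV]; simp
      · have h1 := G.card_edgeFinset_induce_compl_singleton v
        have h2 : G.degree v ≤ G.edgeFinset.card := G.degree_le_card_edgeFinset v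
        rw [card_edgeFinset_deleteIncidenceSet] at h1
        have h3 : ((G.induce {v}ᶜ).edgeFinset.card : ℝ) = G.edgeFinset.card - G.degree v := by
          rw [← Nat.cast_sub h2, ← h1]
        push_cast at hG
        calc δ * n < G.edgeFinset.card - G.degree v := by linarith
          _ = (G.induce {v}ᶜ).edgeFinset.card := h3.symm
          _ = _ := by congr!

/-- For every finite tree `T` with at least one edge and every path `P_t` with
at least one edge (i.e. `t ≥ 2`), there is `C > 0` such that every graph on
`n ≥ 1` vertices with more than `C · n^{3/2}` edges contains `T □ P_t`. -/
theorem turan_tree_box_path_upper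
    (W : Type) [Fintype W] (T : SimpleGraph W) (hT : T.IsTree)
    (hTedge : T.edgeSet.Nonempty) (t : ℕ) (ht : 2 ≤ t) :
    ∃ C : ℝ, 0 < C ∧ ∀ (n : ℕ), 0 < n → ∀ (V : Type) (_ : Fintype V),
      Fintype.card V = n → ∀ G : SimpleGraph V,
        C * (n : ℝ) ^ ((3 : ℝ) / 2) < (G.edgeSet.ncard : ℝ) →
          Contains G (T.boxProd (pathGraph t)) := by
  classical
  set k := Fintype.card W + t
  set N := Fintype.card W * t + (k + 1)
  set c : ℝ := (flipConst k N (Fintype.card W * t) : ℝ) with hc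
  have hc0 : 0 ≤ c := Nat.cast_nonneg _
  refine ⟨c + 1, by positivity, fun n hn V _ hV G hG => ?_⟩
  have hn0 : (0 : ℝ) < n := by exact_mod_cast hn
  have hδ : 0 < (c + 1) * √n := by positivity
  refine contains_of_card_edgeFinset (n₀ := n) (δ := (c + 1) * √n) ?_ n le_rfl V G hV ?_
  · intro V' _ _ G' hV' hdeg
    obtain ⟨g, hg⟩ := exists_flipRich hδ hdeg k N (Fintype.card W * t) (by
      have hle : (Fintype.card V' : ℝ) ≤ n := by exact_mod_cast hV'
      rw [mul_pow, Real.sq_sqrt hn0.le, ← hc]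
      calc c * Fintype.card V' ≤ c * n := by gcongr
        _ < (c + 1) ^ 2 * n := by gcongr; nlinarith)
    exact hg.contains hT le_rfl le_rfl
  · have hpow : (n : ℝ) ^ ((3 : ℝ) / 2) = √n * n := by
      rw [Real.sqrt_eq_rpow]
      nth_rw 3 [← Real.rpow_one (n : ℝ)]
      rw [← Real.rpow_add hn0]
      norm_num
    rw [hpow, ← mul_assoc, ← coe_edgeFinset, Set.ncard_coe_finset] at hG
    exact hG
end
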